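/- arXiv:math/9912140 — 2 statements merged into one kernel-verified Lean document; each statement's English description precedes it below -/
import Mathlib

section
/- Let p ∈ ℤ≥0 and let a, γ be nonzero complex numbers with (a;q)_n ≠ 0 for all n ≥ 0. Then the big q-Bessel function evaluated at the point q^{p+1}/(a·γ) satisfies J_γ(q^{p+1}/(a·γ);a;q) = ₁φ₁(−a·γ·q^{−1−p}; a; q, q^{p+1}) = [(q^{p+1};q)_∞ / (a;q)_∞] · ₁φ₁(−γ; q^{p+1}; q, a). -/
/-- The q-shifted factorial `(a;q)_n = ∏_{j=0}^{n-1} (1 - a q^j)`. -/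
noncomputable def qPoch (a q : ℂ) (n : ℕ) : ℂ := ∏ j ∈ Finset.range n, (1 - a * q ^ j)

/-- The infinite q-shifted factorial `(a;q)_∞ = ∏_{j=0}^∞ (1 - a q^j)`. -/
noncomputable def qPochInf (a q : ℂ) : ℂ := ∏' j : ℕ, (1 - a * q ^ j)

/-- The big q-Bessel function
`J_γ(x;a;q) = ∑ (-1/x;q)_n (-1)^n q^{n(n-1)/2} / ((a;q)_n (q;q)_n) (aγx)^n`. -/
noncomputable def bigQBessel (q a γ x : ℂ) : ℂ :=
  ∑' n : ℕ, qPoch (-1 / x) q n * (-1) ^ n * q ^ (n * (n - 1) / 2) /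
    (qPoch a q n * qPoch q q n) * (a * γ * x) ^ n

/-- The basic hypergeometric series
`₁φ₁(α;β;q,z) = ∑_{n≥0} (α;q)_n (-1)^n q^{n(n-1)/2} / ((β;q)_n (q;q)_n) z^n`. -/
noncomputable def phi11 (q α β z : ℂ) : ℂ :=
  ∑' n : ℕ, qPoch α q n * (-1) ^ n * q ^ (n * (n - 1) / 2) /
    (qPoch β q n * qPoch q q n) * z ^ n

theorem qPoch_zero (a q : ℂ) : qPoch a q 0 = 1 := by simp [qPoch]

theorem qPoch_succ (a q : ℂ) (n : ℕ) : qPoch a q (n + 1) = qPoch a q n * (1 - a * q ^ n) := by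
  simp [qPoch, Finset.prod_range_succ]

theorem one_sub_pow_succ_ne_zero {q : ℂ} (hq : ‖q‖ < 1) (n : ℕ) : 1 - q ^ (n + 1) ≠ 0 := by
  intro h
  have h1 : ‖q ^ (n + 1)‖ < 1 := by
    rw [norm_pow]
    exact pow_lt_one₀ (norm_nonneg q) hq (Nat.succ_ne_zero n)
  rw [← sub_eq_zero.mp h] at h1
  simp at h1

theorem qPoch_pow_succ_ne_zero {q : ℂ} (hq : ‖q‖ < 1) (p n : ℕ) :
    qPoch (q ^ (p + 1)) q n ≠ 0 := by
  refine Finset.prod_ne_zero_iff.mpr fun j _ => ?_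
  rw [← pow_add, show p + 1 + j = p + j + 1 by ring]
  exact one_sub_pow_succ_ne_zero hq _

theorem qPoch_self_ne_zero {q : ℂ} (hq : ‖q‖ < 1) (n : ℕ) : qPoch q q n ≠ 0 := by
  simpa using qPoch_pow_succ_ne_zero hq 0 n

theorem qPoch_self_succ (q : ℂ) (n : ℕ) :
    qPoch q q (n + 1) = qPoch q q n * (1 - q ^ (n + 1)) := by
  rw [qPoch_succ, pow_succ' q n]

theorem pow_triangle_succ (q : ℂ) (n : ℕ) :
    q ^ ((n + 1) * (n + 1 - 1) / 2) = q ^ (n * (n - 1) / 2) * q ^ n := by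
  rw [Nat.triangle_succ, pow_add]

theorem triangle_add (n m : ℕ) :
    (n + m) * (n + m - 1) / 2 = n * (n - 1) / 2 + m * (m - 1) / 2 + n * m := by
  induction m with
  | zero => simp
  | succ m ih =>
    rw [← add_assoc, Nat.triangle_succ, Nat.triangle_succ, ih]
    ring

theorem summable_norm_of_ratio_tendsto_zero {f ρ : ℕ → ℂ}
    (hf : ∀ n, f (n + 1) = f n * ρ n) (hρ : Filter.Tendsto ρ Filter.atTop (nhds 0)) :
    Summable fun n => ‖f n‖ := by
  refine summable_of_ratio_norm_eventually_le (r := 1 / 2) (by norm_num) ?_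
  have h := hρ.norm
  rw [norm_zero] at h
  filter_upwards [h.eventually (ge_mem_nhds (show (0 : ℝ) < 1 / 2 by norm_num))] with n hn
  rw [hf, norm_mul, norm_mul, norm_norm, norm_norm, mul_comm]
  gcongr

/-- The terms of `₁φ₁(α;0;q,z)`. -/
noncomputable def phi10Term (q α z : ℂ) (n : ℕ) : ℂ :=
  qPoch α q n * (-1) ^ n * q ^ (n * (n - 1) / 2) / qPoch q q n * z ^ n

theorem phi10Term_succ {q : ℂ} (α z : ℂ) (n : ℕ) :
    phi10Term q α z (n + 1) =
      phi10Term q α z n * (-((1 - α * q ^ n) * q ^ n * z / (1 - q ^ (n + 1)))) := by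
  rw [phi10Term, phi10Term, qPoch_succ, pow_triangle_succ, qPoch_self_succ]
  simp only [div_eq_mul_inv, mul_inv]
  ring

theorem summable_norm_phi10Term {q : ℂ} (hq : ‖q‖ < 1) (α z : ℂ) :
    Summable fun n => ‖phi10Term q α z n‖ := by
  refine summable_norm_of_ratio_tendsto_zero (phi10Term_succ α z) ?_
  have h0 := tendsto_pow_atTop_nhds_zero_of_norm_lt_one hq
  have h1 := h0.comp (Filter.tendsto_add_atTop_nat 1)
  have h2 := (((((h0.const_mul α).const_sub 1).mul h0).mul_const z).div (h1.const_sub 1)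
    (by norm_num)).neg
  simpa using h2

/-- Euler's series `∑ (-1)^n q^{n(n-1)/2} x^n / (q;q)_n`. -/
noncomputable def eulerSeries (q x : ℂ) : ℂ := ∑' n : ℕ, phi10Term q 0 x n

theorem phi10Term_zero_left (q x : ℂ) (n : ℕ) :
    phi10Term q 0 x n = (-1) ^ n * q ^ (n * (n - 1) / 2) / qPoch q q n * x ^ n := by
  simp [phi10Term, qPoch]

theorem eulerSeries_eq_mul {q : ℂ} (hq : ‖q‖ < 1) (x : ℂ) :
    eulerSeries q x = (1 - x) * eulerSeries q (x * q) := by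
  have hs : ∀ y, Summable (phi10Term q 0 y) := fun y => (summable_norm_phi10Term hq 0 y).of_norm
  have hs' : ∀ y, Summable fun n => phi10Term q 0 y (n + 1) :=
    fun y => (summable_nat_add_iff 1).mpr (hs y)
  have hz : ∀ y, phi10Term q 0 y 0 = 1 := fun y => by simp [phi10Term, qPoch]
  have key : ∀ n, phi10Term q 0 x (n + 1) =
      phi10Term q 0 (x * q) (n + 1) - x * phi10Term q 0 (x * q) n := fun n => by
    have h1 := one_sub_pow_succ_ne_zero hq n
    have h2 := qPoch_self_ne_zero hq n
    simp only [phi10Term_zero_left, pow_triangle_succ, qPoch_self_succ]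
    field_simp
    ring
  have e1 := (hs x).tsum_eq_zero_add
  have e2 := (hs (x * q)).tsum_eq_zero_add
  rw [tsum_congr key, (hs' _).tsum_sub ((hs _).mul_left x), tsum_mul_left, hz] at e1
  rw [hz] at e2
  unfold eulerSeries
  linear_combination e1 - e2

theorem eulerSeries_eq_qPoch_mul {q : ℂ} (hq : ‖q‖ < 1) (x : ℂ) (n : ℕ) :
    eulerSeries q x = qPoch x q n * eulerSeries q (x * q ^ n) := by
  induction n with
  | zero => simp [qPoch_zero]
  | succ n ih => rw [ih, eulerSeries_eq_mul hq (x * q ^ n), qPoch_succ, pow_succ]; ring_nf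

theorem tendsto_eulerSeries {q : ℂ} (hq : ‖q‖ < 1) (x : ℂ) :
    Filter.Tendsto (fun n : ℕ => eulerSeries q (x * q ^ n)) Filter.atTop (nhds 1) := by
  have h0 : ∑' k, phi10Term q 0 0 k = 1 := by
    rw [tsum_eq_single 0 fun k hk => by simp [phi10Term, hk]]
    simp [phi10Term, qPoch]
  rw [← h0]
  refine tendsto_tsum_of_dominated_convergence (summable_norm_phi10Term hq 0 x) (fun k => ?_)
    (Filter.Eventually.of_forall fun n k => ?_)
  · have h1 := (tendsto_pow_atTop_nhds_zero_of_norm_lt_one hq).const_mul x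
    rw [mul_zero] at h1
    exact (h1.pow k).const_mul _
  · rw [phi10Term, phi10Term, norm_mul, norm_mul _ (x ^ k), norm_pow, norm_pow, norm_mul, norm_pow]
    gcongr
    exact mul_le_of_le_one_right (norm_nonneg x) (pow_le_one₀ (norm_nonneg q) hq.le)

theorem qPochInf_eq_eulerSeries {q : ℂ} (hq : ‖q‖ < 1) (x : ℂ) :
    qPochInf x q = eulerSeries q x := by
  have hm : Multipliable fun j : ℕ => 1 - x * q ^ j := by
    simp only [sub_eq_add_neg]
    refine multipliable_one_add_of_summable ?_
    simp only [norm_neg, norm_mul, norm_pow]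
    exact (summable_geometric_of_lt_one (norm_nonneg q) hq).mul_left _
  have h1 := hm.hasProd.tendsto_prod_nat.mul (tendsto_eulerSeries hq x)
  rw [mul_one] at h1
  refine tendsto_nhds_unique h1 (tendsto_const_nhds.congr fun n => ?_)
  exact eulerSeries_eq_qPoch_mul hq x n

theorem qPochInf_ne_zero {q : ℂ} (hq : ‖q‖ < 1) {x : ℂ} (hx : ∀ n, qPoch x q n ≠ 0) :
    qPochInf x q ≠ 0 := by
  obtain ⟨n, hn⟩ := ((tendsto_eulerSeries hq x).eventually_ne one_ne_zero).exists
  rw [qPochInf_eq_eulerSeries hq, eulerSeries_eq_qPoch_mul hq x n]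
  exact mul_ne_zero (hx n) hn

/-- The generating function `∑ (α;q)_n z^n t^n / (q;q)_n`. -/
noncomputable def qBinomialSeries (q α z : ℂ) : PowerSeries ℂ :=
  PowerSeries.mk fun n => qPoch α q n * z ^ n / qPoch q q n

theorem qBinomialSeries_functional {q : ℂ} (hq : ‖q‖ < 1) (α z : ℂ) :
    (1 - PowerSeries.C z * PowerSeries.X) * qBinomialSeries q α z =
      (1 - PowerSeries.C (α * z) * PowerSeries.X) *
        PowerSeries.rescale q (qBinomialSeries q α z) := by
  ext n
  rw [sub_mul, sub_mul, one_mul, one_mul, mul_assoc, mul_assoc, map_sub, map_sub,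
    PowerSeries.coeff_C_mul, PowerSeries.coeff_C_mul]
  cases n with
  | zero => simp [qBinomialSeries]
  | succ n =>
    have h1 := one_sub_pow_succ_ne_zero hq n
    have h2 := qPoch_self_ne_zero hq n
    simp only [PowerSeries.coeff_succ_X_mul, PowerSeries.coeff_rescale, qBinomialSeries,
      PowerSeries.coeff_mk, qPoch_self_succ, qPoch_succ α]
    field_simp
    ring

theorem constantCoeff_qBinomialSeries (q α z : ℂ) :
    PowerSeries.constantCoeff (qBinomialSeries q α z) = 1 := by
  simp [qBinomialSeries, ← PowerSeries.coeff_zero_eq_constantCoeff_apply, qPoch]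

theorem PowerSeries.eq_of_rescale_eq {q : ℂ} (hq : ‖q‖ < 1) {z : ℂ} {F G : PowerSeries ℂ}
    (hF : (1 - PowerSeries.C z * PowerSeries.X) * F = PowerSeries.rescale q F)
    (hG : (1 - PowerSeries.C z * PowerSeries.X) * G = PowerSeries.rescale q G)
    (h0 : PowerSeries.constantCoeff F = PowerSeries.constantCoeff G) : F = G := by
  have key : ∀ {H : PowerSeries ℂ},
      (1 - PowerSeries.C z * PowerSeries.X) * H = PowerSeries.rescale q H → ∀ n,
      (1 - q ^ (n + 1)) * PowerSeries.coeff (n + 1) H = z * PowerSeries.coeff n H := by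
    intro H hH n
    have := congrArg (PowerSeries.coeff (n + 1)) hH
    rw [sub_mul, one_mul, mul_assoc, map_sub, PowerSeries.coeff_C_mul,
      PowerSeries.coeff_succ_X_mul, PowerSeries.coeff_rescale] at this
    linear_combination this
  ext n
  induction n with
  | zero => simpa using h0
  | succ n ih =>
    refine mul_left_cancel₀ (one_sub_pow_succ_ne_zero hq n) ?_
    rw [key hF, key hG, ih]

/-- The formal `q`-binomial theorem, with the denominator cleared. -/
theorem qBinomialSeries_mul {q : ℂ} (hq : ‖q‖ < 1) (α z : ℂ) :
    qBinomialSeries q α z * qBinomialSeries q 0 (α * z) = qBinomialSeries q 0 z := by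
  have h0 : ∀ y, (1 - PowerSeries.C y * PowerSeries.X) * qBinomialSeries q 0 y =
      PowerSeries.rescale q (qBinomialSeries q 0 y) := fun y => by
    simpa using qBinomialSeries_functional hq 0 y
  refine PowerSeries.eq_of_rescale_eq hq (z := z) ?_ (h0 z) ?_
  · rw [map_mul, ← h0, ← mul_assoc, qBinomialSeries_functional hq]
    ring
  · simp [constantCoeff_qBinomialSeries]

theorem qBinomialSeries_mul_comm {q : ℂ} (hq : ‖q‖ < 1) {α β z c : ℂ} (h : α * z = β * c) :
    qBinomialSeries q α z * qBinomialSeries q 0 c =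
      qBinomialSeries q β c * qBinomialSeries q 0 z := by
  have hne : qBinomialSeries q 0 (α * z) ≠ 0 := fun h0 => by
    have := constantCoeff_qBinomialSeries q 0 (α * z)
    simp [h0] at this
  refine mul_right_cancel₀ hne ?_
  rw [mul_right_comm, qBinomialSeries_mul hq, mul_right_comm, h, qBinomialSeries_mul hq, mul_comm]

theorem qPochInf_mul_phi11_eq_tsum {q : ℂ} (hq : ‖q‖ < 1) (α z : ℂ) {c : ℂ}
    (hc : ∀ n, qPoch c q n ≠ 0) :
    qPochInf c q * phi11 q α c z = ∑' N : ℕ, (-1) ^ N * q ^ (N * (N - 1) / 2) *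
      PowerSeries.coeff N (qBinomialSeries q α z * qBinomialSeries q 0 c) := by
  set F : ℕ × ℕ → ℂ := fun x => phi10Term q α z x.1 * phi10Term q 0 (c * q ^ x.1) x.2 with hF
  have hsum : Summable F := by
    refine Summable.of_norm_bounded
      ((summable_norm_phi10Term hq α z).mul_of_nonneg (summable_norm_phi10Term hq 0 c)
        (fun _ => norm_nonneg _) fun _ => norm_nonneg _) fun x => ?_
    rw [hF, norm_mul]
    refine mul_le_mul_of_nonneg_left ?_ (norm_nonneg _)
    rw [phi10Term, phi10Term, norm_mul, norm_mul _ (c ^ x.2), norm_pow, norm_pow, norm_mul,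
      norm_pow]
    gcongr
    exact mul_le_of_le_one_right (norm_nonneg c) (pow_le_one₀ (norm_nonneg q) hq.le)
  have hL : qPochInf c q * phi11 q α c z = ∑' x, F x := by
    rw [hsum.tsum_prod, phi11, ← tsum_mul_left]
    refine tsum_congr fun n => ?_
    simp only [hF]
    rw [tsum_mul_left, qPochInf_eq_eulerSeries hq, eulerSeries_eq_qPoch_mul hq c n,
      eulerSeries, phi10Term]
    have h1 := hc n
    have h2 := qPoch_self_ne_zero hq n
    field_simp
  have hsum' : Summable fun x : (N : ℕ) × Finset.HasAntidiagonal.antidiagonal N =>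
      F (Finset.HasAntidiagonal.sigmaAntidiagonalEquivProd x) :=
    Finset.HasAntidiagonal.sigmaAntidiagonalEquivProd.summable_iff.mpr hsum
  rw [hL, ← Finset.HasAntidiagonal.sigmaAntidiagonalEquivProd.tsum_eq F, hsum'.tsum_sigma]
  refine tsum_congr fun N => ?_
  rw [tsum_fintype, PowerSeries.coeff_mul, Finset.mul_sum,
    ← Finset.sum_coe_sort (Finset.HasAntidiagonal.antidiagonal N)]
  refine Finset.sum_congr rfl fun x _ => ?_
  obtain ⟨⟨n, m⟩, hx⟩ := x
  obtain rfl := Finset.HasAntidiagonal.mem_antidiagonal.mp hx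
  simp only [hF, Finset.HasAntidiagonal.sigmaAntidiagonalEquivProd_apply, phi10Term, qBinomialSeries,
    PowerSeries.coeff_mk, triangle_add, pow_add, mul_pow, ← pow_mul]
  simp only [div_eq_mul_inv]
  ring

/-- The symmetry `(c;q)_∞ ₁φ₁(α;c;q,z) = (z;q)_∞ ₁φ₁(αz/c;z;q,c)`. -/
theorem qPochInf_mul_phi11_comm {q : ℂ} (hq : ‖q‖ < 1) {α β z c : ℂ} (h : α * z = β * c)
    (hc : ∀ n, qPoch c q n ≠ 0) (hz : ∀ n, qPoch z q n ≠ 0) :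
    qPochInf c q * phi11 q α c z = qPochInf z q * phi11 q β z c := by
  rw [qPochInf_mul_phi11_eq_tsum hq α z hc, qPochInf_mul_phi11_eq_tsum hq β c hz,
    qBinomialSeries_mul_comm hq h]

theorem bigQBessel_at_special_points (q : ℝ) (hq0 : 0 < q) (hq1 : q < 1)
    (p : ℕ) (a γ : ℂ) (ha : a ≠ 0) (hγ : γ ≠ 0)
    (haP : ∀ n : ℕ, qPoch a (q : ℂ) n ≠ 0) :
    bigQBessel (q : ℂ) a γ ((q : ℂ) ^ (p + 1) / (a * γ)) =
        phi11 (q : ℂ) (-(a * γ * (q : ℂ) ^ (-(1 : ℤ) - (p : ℤ)))) a ((q : ℂ) ^ (p + 1)) ∧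
      phi11 (q : ℂ) (-(a * γ * (q : ℂ) ^ (-(1 : ℤ) - (p : ℤ)))) a ((q : ℂ) ^ (p + 1)) =
        (qPochInf ((q : ℂ) ^ (p + 1)) (q : ℂ) / qPochInf a (q : ℂ)) *
          phi11 (q : ℂ) (-γ) ((q : ℂ) ^ (p + 1)) a := by
  have hq : ‖(q : ℂ)‖ < 1 := by
    rwa [Complex.norm_real, Real.norm_of_nonneg hq0.le]
  have hq' : (q : ℂ) ≠ 0 := by exact_mod_cast hq0.ne'
  have hpow : (q : ℂ) ^ (-(1 : ℤ) - (p : ℤ)) = ((q : ℂ) ^ (p + 1))⁻¹ := by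
    rw [show -(1 : ℤ) - (p : ℤ) = -((p + 1 : ℕ) : ℤ) by push_cast; ring, zpow_neg, zpow_natCast]
  have hqp : (q : ℂ) ^ (p + 1) ≠ 0 := pow_ne_zero _ hq'
  rw [hpow]
  constructor
  · have h1 : -1 / ((q : ℂ) ^ (p + 1) / (a * γ)) = -(a * γ * ((q : ℂ) ^ (p + 1))⁻¹) := by
      field_simp
    have h2 : a * γ * ((q : ℂ) ^ (p + 1) / (a * γ)) = (q : ℂ) ^ (p + 1) := by
      field_simp
    rw [bigQBessel, phi11, h1, h2]
  · rw [div_mul_eq_mul_div, eq_div_iff (qPochInf_ne_zero hq haP), mul_comm]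
    refine qPochInf_mul_phi11_comm hq ?_ haP (qPoch_pow_succ_ne_zero hq p)
    field_simp
end

section
/- Let a, b, γ, x be nonzero complex numbers with (ab;q)_n ≠ 0 for all n ≥ 0. Then, as the real parameter ε tends to 0 from above (so that |εb·εx| < 1 for all sufficiently small ε and the left-hand side is defined), the little q-Jacobi function φ_{γ/ε}(ε·x; a/ε; ε·b; q) tends to the big q-Bessel function J_{ax}(−γ/a; ab; q) = ₁φ₁(a/γ; ab; q, −a·b·γ·x). -/
open Filter Topology

/-- The little q-Jacobi function
`φ_γ(x;a;b;q) = ∑_{n≥0} (aγ;q)_n (a/γ;q)_n / ((ab;q)_n (q;q)_n) (-bx)^n`. -/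
noncomputable def littleQJacobi (q a b γ x : ℂ) : ℂ :=
  ∑' n : ℕ, qPoch (a * γ) q n * qPoch (a / γ) q n /
    (qPoch (a * b) q n * qPoch q q n) * (-(b * x)) ^ n

theorem summable_prod_range_of_tendsto_lt_one {r : ℕ → ℝ} {l : ℝ} (hl : l < 1)
    (hpos : ∀ n, 0 < r n) (hr : Tendsto r atTop (𝓝 l)) :
    Summable fun n : ℕ => ∏ j ∈ Finset.range n, r j := by
  have hP : ∀ n : ℕ, 0 < ∏ j ∈ Finset.range n, r j := fun n =>
    Finset.prod_pos fun j _ => hpos j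
  refine summable_of_ratio_test_tendsto_lt_one hl
    (Eventually.of_forall fun n => (hP n).ne') (hr.congr fun n => ?_)
  rw [Real.norm_of_nonneg (hP _).le, Real.norm_of_nonneg (hP _).le, Finset.prod_range_succ,
    mul_div_cancel_left₀ _ (hP n).ne']

theorem one_sub_mul_pow_ne_zero_of_qPoch_ne_zero {a q : ℂ} (h : ∀ n, qPoch a q n ≠ 0) (n : ℕ) :
    1 - a * q ^ n ≠ 0 := by
  have := h (n + 1)
  rw [qPoch, Finset.prod_range_succ] at this
  exact right_ne_zero_of_mul this

theorem pow_mul_sub_one_div_two_eq_prod (q : ℂ) (n : ℕ) :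
    q ^ (n * (n - 1) / 2) = ∏ j ∈ Finset.range n, q ^ j := by
  rw [Finset.prod_pow_eq_pow_sum, Finset.sum_range_id]

theorem phi11_term_eq_prod (q α β z : ℂ) (n : ℕ) :
    qPoch α q n * (-1) ^ n * q ^ (n * (n - 1) / 2) / (qPoch β q n * qPoch q q n) * z ^ n =
      ∏ j ∈ Finset.range n,
        (1 - α * q ^ j) * (-z * q ^ j) / ((1 - β * q ^ j) * (1 - q * q ^ j)) := by
  rw [pow_mul_sub_one_div_two_eq_prod, Finset.prod_div_distrib, Finset.prod_mul_distrib,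
    Finset.prod_mul_distrib, Finset.prod_mul_distrib, Finset.prod_const, Finset.card_range, neg_pow z]
  simp only [qPoch]
  ring

theorem littleQJacobi_term_eq_prod (q c α β w : ℂ) (n : ℕ) :
    qPoch c q n * qPoch α q n / (qPoch β q n * qPoch q q n) * w ^ n =
      ∏ j ∈ Finset.range n,
        (1 - α * q ^ j) * (w - c * w * q ^ j) / ((1 - β * q ^ j) * (1 - q * q ^ j)) := by
  have hw : ∏ j ∈ Finset.range n, (w - c * w * q ^ j) =
      w ^ n * ∏ j ∈ Finset.range n, (1 - c * q ^ j) := by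
    rw [← Finset.card_range n, ← Finset.prod_const, Finset.card_range, ← Finset.prod_mul_distrib]
    exact Finset.prod_congr rfl fun j _ => by ring
  rw [Finset.prod_div_distrib, Finset.prod_mul_distrib, Finset.prod_mul_distrib, hw]
  simp only [qPoch]
  ring

/-- Termwise passage to the limit `w → 0`, with `c w` fixed equal to `z`, from `₂φ₁` to `₁φ₁`. -/
theorem tendsto_tsum_prod_phi11 {q : ℝ} (hq0 : 0 < q) (hq1 : q < 1) (α β z : ℂ)
    (hβ : ∀ n, qPoch β (q : ℂ) n ≠ 0) :
    Tendsto (fun w : ℂ => ∑' n : ℕ, ∏ j ∈ Finset.range n,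
        (1 - α * (q : ℂ) ^ j) * (w - z * (q : ℂ) ^ j) /
          ((1 - β * (q : ℂ) ^ j) * (1 - (q : ℂ) * (q : ℂ) ^ j)))
      (𝓝 0) (𝓝 (phi11 (q : ℂ) α β z)) := by
  have hβ' := one_sub_mul_pow_ne_zero_of_qPoch_ne_zero hβ
  have hqq : ∀ n : ℕ, 1 - (q : ℂ) * (q : ℂ) ^ n ≠ 0 := by
    intro n h
    have h1 : q ^ (n + 1) < 1 := pow_lt_one₀ hq0.le hq1 n.succ_ne_zero
    have h2 : ((q ^ (n + 1) : ℝ) : ℂ) = 1 := by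
      push_cast
      rw [pow_succ']
      exact (sub_eq_zero.mp h).symm
    exact h1.ne (by exact_mod_cast h2)
  have hnq : ∀ n : ℕ, ‖(q : ℂ) ^ n‖ = q ^ n := fun n => by
    rw [norm_pow, Complex.norm_of_nonneg hq0.le]
  have hqt : Tendsto (fun n : ℕ => q ^ n) atTop (𝓝 0) :=
    tendsto_pow_atTop_nhds_zero_of_lt_one hq0.le hq1
  have hqc : Tendsto (fun n : ℕ => (q : ℂ) ^ n) atTop (𝓝 0) :=
    tendsto_pow_atTop_nhds_zero_of_norm_lt_one (by rwa [Complex.norm_of_nonneg hq0.le])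
  set r : ℕ → ℝ := fun j => (1 + ‖α‖ * q ^ j) * (1 / 2 + ‖z‖ * q ^ j) /
    (‖1 - β * (q : ℂ) ^ j‖ * ‖1 - (q : ℂ) * (q : ℂ) ^ j‖) with hr
  have hrpos : ∀ n, 0 < r n := fun n => by
    have h1 := norm_pos_iff.mpr (hβ' n)
    have h2 := norm_pos_iff.mpr (hqq n)
    simp only [hr]
    positivity
  have hrt : Tendsto r atTop (𝓝 (1 / 2)) := by
    have hnum := ((hqt.const_mul ‖α‖).const_add 1).mul ((hqt.const_mul ‖z‖).const_add (1 / 2))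
    have hden := ((hqc.const_mul β).const_sub 1).norm.mul ((hqc.const_mul (q : ℂ)).const_sub 1).norm
    have : Tendsto r atTop _ := hnum.div hden (by simp)
    simpa using this
  simp only [phi11, phi11_term_eq_prod]
  refine tendsto_tsum_of_dominated_convergence
    (summable_prod_range_of_tendsto_lt_one (by norm_num) hrpos hrt) (fun n => ?_) ?_
  · refine tendsto_finsetProd _ fun j _ => ?_
    have : Tendsto (fun w : ℂ => w - z * (q : ℂ) ^ j) (𝓝 0) (𝓝 (-z * (q : ℂ) ^ j)) := by
      simpa using (tendsto_id (α := ℂ) (x := 𝓝 0)).sub_const (z * (q : ℂ) ^ j)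
    exact (this.const_mul _).div_const _
  · filter_upwards [Metric.ball_mem_nhds (0 : ℂ) (by norm_num : (0 : ℝ) < 1 / 2)] with w hw n
    rw [mem_ball_zero_iff] at hw
    rw [norm_prod]
    refine Finset.prod_le_prod (fun _ _ => norm_nonneg _) fun j _ => ?_
    rw [norm_div, norm_mul, norm_mul]
    have h1 : ‖1 - α * (q : ℂ) ^ j‖ ≤ 1 + ‖α‖ * q ^ j := by
      simpa [hnq] using norm_sub_le (1 : ℂ) (α * (q : ℂ) ^ j)
    have h2 : ‖w - z * (q : ℂ) ^ j‖ ≤ 1 / 2 + ‖z‖ * q ^ j := by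
      have := norm_sub_le w (z * (q : ℂ) ^ j)
      rw [norm_mul, hnq] at this
      linarith
    simp only [hr]
    gcongr

theorem littleQJacobi_to_dual_bigQBessel (q : ℝ) (hq0 : 0 < q) (hq1 : q < 1)
    (a b γ x : ℂ) (ha : a ≠ 0) (hb : b ≠ 0) (hγ : γ ≠ 0) (hx : x ≠ 0)
    (hab : ∀ n : ℕ, qPoch (a * b) (q : ℂ) n ≠ 0) :
    Tendsto (fun ε : ℝ =>
          littleQJacobi (q : ℂ) (a / (ε : ℂ)) ((ε : ℂ) * b) (γ / (ε : ℂ)) ((ε : ℂ) * x))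
        (𝓝[>] (0 : ℝ)) (𝓝 (bigQBessel (q : ℂ) (a * b) (a * x) (-(γ / a)))) ∧
      bigQBessel (q : ℂ) (a * b) (a * x) (-(γ / a)) =
        phi11 (q : ℂ) (a / γ) (a * b) (-(a * b * γ * x)) := by
  have hJ : bigQBessel (q : ℂ) (a * b) (a * x) (-(γ / a)) =
      phi11 (q : ℂ) (a / γ) (a * b) (-(a * b * γ * x)) := by
    have h1 : -1 / (-(γ / a)) = a / γ := by field_simp
    have h2 : a * b * (a * x) * (-(γ / a)) = -(a * b * γ * x) := by field_simp
    rw [bigQBessel, phi11, h1, h2]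
  refine ⟨?_, hJ⟩
  rw [hJ]
  have hw : Tendsto (fun ε : ℝ => -((ε : ℂ) * b * ((ε : ℂ) * x))) (𝓝[>] 0) (𝓝 0) := by
    have : Continuous fun ε : ℝ => -((ε : ℂ) * b * ((ε : ℂ) * x)) := by fun_prop
    simpa using (this.tendsto 0).mono_left nhdsWithin_le_nhds
  refine ((tendsto_tsum_prod_phi11 hq0 hq1 (a / γ) (a * b) (-(a * b * γ * x)) hab).comp
    hw).congr' ?_
  filter_upwards [self_mem_nhdsWithin] with ε hε
  have hε' : (ε : ℂ) ≠ 0 := by exact_mod_cast (Set.mem_Ioi.mp hε).ne'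
  have h1 : a / (ε : ℂ) / (γ / (ε : ℂ)) = a / γ := by field_simp
  have h2 : a / (ε : ℂ) * ((ε : ℂ) * b) = a * b := by field_simp
  have h3 : a / (ε : ℂ) * (γ / (ε : ℂ)) * -((ε : ℂ) * b * ((ε : ℂ) * x)) =
      -(a * b * γ * x) := by field_simp
  simp only [littleQJacobi, Function.comp_apply, littleQJacobi_term_eq_prod, h1, h2, h3]
end
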